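/- arXiv:1712.09499 — 3 statements merged into one kernel-verified Lean document; each statement's English description precedes it below -/
import Mathlib

section
/- Let A ⊆ C be a unital inclusion of unital C*-algebras with A' ∩ C = C·1, E^A of Watatani index-finite type, with C*-basic constructions C_1 (for E^A) and C_2 (for the dual expectation E^C), and let (X,Y) ∈ Equi(A,C) with upward basic construction Y_1 = C⊗_A X⊗_A C̃. Let E^{C̃⊗_{C_1}Y_1⊗_{C_1}C} denote the unique conditional expectation from C̃_1⊗_{C_2}C_1⊗_C Y⊗_C C̃_1⊗_{C_2}C_1 onto C̃⊗_{C_1}Y_1⊗_{C_1}C with respect to E^A and E^A. Then for all a_1, b_1, c_1, d_1 ∈ C_1 and y ∈ Y: E^{C̃⊗_{C_1}Y_1⊗_{C_1}C}(c̃_1 ⊗ a_1 ⊗ y ⊗ b̃_1 ⊗ d_1) = (E^C(a_1* c_1))~ ⊗ y ⊗ E^C(b_1* d_1). -/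
open scoped MultiplierAlgebra

noncomputable section

structure EquivBimodule (C D Y : Type*)
    [NonUnitalCStarAlgebra C] [PartialOrder C] [StarOrderedRing C]
    [NonUnitalCStarAlgebra D] [PartialOrder D] [StarOrderedRing D]
    [NormedAddCommGroup Y] [NormedSpace ℂ Y] [CompleteSpace Y] : Type _ where
  lsmul : C → Y → Y
  rsmul : Y → D → Y
  linn : Y → Y → C
  rinn : Y → Y → D
  lsmul_add : ∀ c x y, lsmul c (x + y) = lsmul c x + lsmul c y
  add_lsmul : ∀ c c' x, lsmul (c + c') x = lsmul c x + lsmul c' x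
  mul_lsmul : ∀ c c' x, lsmul (c * c') x = lsmul c (lsmul c' x)
  smul_lsmul : ∀ (z : ℂ) c x, lsmul (z • c) x = z • lsmul c x
  lsmul_smul : ∀ (z : ℂ) c x, lsmul c (z • x) = z • lsmul c x
  add_rsmul : ∀ x y d, rsmul (x + y) d = rsmul x d + rsmul y d
  rsmul_add : ∀ x d d', rsmul x (d + d') = rsmul x d + rsmul x d'
  rsmul_mul : ∀ x d d', rsmul x (d * d') = rsmul (rsmul x d) d'
  rsmul_smul : ∀ (z : ℂ) x d, rsmul (z • x) d = z • rsmul x d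
  smul_rsmul : ∀ (z : ℂ) x d, rsmul x (z • d) = z • rsmul x d
  lsmul_rsmul : ∀ c x d, rsmul (lsmul c x) d = lsmul c (rsmul x d)
  linn_add_left : ∀ x y z, linn (x + y) z = linn x z + linn y z
  linn_smul_left : ∀ (t : ℂ) x y, linn (t • x) y = t • linn x y
  linn_star : ∀ x y, star (linn x y) = linn y x
  linn_lsmul_left : ∀ c x y, linn (lsmul c x) y = c * linn x y
  linn_nonneg : ∀ x, 0 ≤ linn x x
  linn_definite : ∀ x, linn x x = 0 → x = 0
  rinn_add_right : ∀ x y z, rinn x (y + z) = rinn x y + rinn x z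
  rinn_smul_right : ∀ (t : ℂ) x y, rinn x (t • y) = t • rinn x y
  rinn_star : ∀ x y, star (rinn x y) = rinn y x
  rinn_rsmul_right : ∀ x y d, rinn x (rsmul y d) = rinn x y * d
  rinn_nonneg : ∀ x, 0 ≤ rinn x x
  rinn_definite : ∀ x, rinn x x = 0 → x = 0
  imprimitivity : ∀ x y z, lsmul (linn x y) z = rsmul x (rinn y z)
  norm_linn : ∀ x, ‖linn x x‖ = ‖x‖ ^ 2
  norm_rinn : ∀ x, ‖rinn x x‖ = ‖x‖ ^ 2
  full_left : Dense (Submodule.span ℂ {c : C | ∃ x y, c = linn x y} : Set C)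
  full_right : Dense (Submodule.span ℂ {d : D | ∃ x y, d = rinn x y} : Set D)

namespace EquivBimodule

variable {C D Y W : Type*}
    [NonUnitalCStarAlgebra C] [PartialOrder C] [StarOrderedRing C]
    [NonUnitalCStarAlgebra D] [PartialOrder D] [StarOrderedRing D]
    [NormedAddCommGroup Y] [NormedSpace ℂ Y] [CompleteSpace Y]
    [NormedAddCommGroup W] [NormedSpace ℂ W] [CompleteSpace W]

structure Iso (E : EquivBimodule C D Y) (F : EquivBimodule C D W) where
  toEquiv : Y ≃ₗ[ℂ] W
  map_lsmul : ∀ c y, toEquiv (E.lsmul c y) = F.lsmul c (toEquiv y)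
  map_rsmul : ∀ y d, toEquiv (E.rsmul y d) = F.rsmul (toEquiv y) d
  map_linn : ∀ x y, F.linn (toEquiv x) (toEquiv y) = E.linn x y
  map_rinn : ∀ x y, F.rinn (toEquiv x) (toEquiv y) = E.rinn x y

end EquivBimodule

def DenseIncl {A C : Type*} [NonUnitalCStarAlgebra C] (ι : A → C) : Prop :=
  Dense (Submodule.span ℂ {x : C | ∃ (a : A) (c : C), x = ι a * c} : Set C)

structure IsMoritaIncl {A B C D Y : Type*}
    [NonUnitalCStarAlgebra C] [PartialOrder C] [StarOrderedRing C]
    [NonUnitalCStarAlgebra D] [PartialOrder D] [StarOrderedRing D]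
    [NormedAddCommGroup Y] [NormedSpace ℂ Y] [CompleteSpace Y]
    (ιA : A → C) (ιB : B → D)
    (E : EquivBimodule C D Y) (X : Submodule ℂ Y) : Prop where
  closed : IsClosed (X : Set Y)
  lsmul_mem : ∀ (a : A), ∀ x ∈ X, E.lsmul (ιA a) x ∈ X
  rsmul_mem : ∀ (b : B), ∀ x ∈ X, E.rsmul x (ιB b) ∈ X
  linn_mem : ∀ x ∈ X, ∀ y ∈ X, E.linn x y ∈ Set.range ιA
  rinn_mem : ∀ x ∈ X, ∀ y ∈ X, E.rinn x y ∈ Set.range ιB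
  span_XX_left :
    closure (Submodule.span ℂ {c : C | ∃ x ∈ X, ∃ y ∈ X, c = E.linn x y} : Set C) = Set.range ιA
  span_YX_left :
    Dense (Submodule.span ℂ {c : C | ∃ (y : Y), ∃ x ∈ X, c = E.linn y x} : Set C)
  span_XX_right :
    closure (Submodule.span ℂ {d : D | ∃ x ∈ X, ∃ y ∈ X, d = E.rinn x y} : Set D) = Set.range ιB
  span_YX_right :
    Dense (Submodule.span ℂ {d : D | ∃ (y : Y), ∃ x ∈ X, d = E.rinn y x} : Set D)

abbrev IsEquiPair {A C Y : Type*}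
    [NonUnitalCStarAlgebra C] [PartialOrder C] [StarOrderedRing C]
    [NormedAddCommGroup Y] [NormedSpace ℂ Y] [CompleteSpace Y]
    (ι : A → C) (E : EquivBimodule C C Y) (X : Submodule ℂ Y) : Prop :=
  IsMoritaIncl ι ι E X

def PairEquiv {C D Y W : Type*}
    [NonUnitalCStarAlgebra C] [PartialOrder C] [StarOrderedRing C]
    [NonUnitalCStarAlgebra D] [PartialOrder D] [StarOrderedRing D]
    [NormedAddCommGroup Y] [NormedSpace ℂ Y] [CompleteSpace Y]
    [NormedAddCommGroup W] [NormedSpace ℂ W] [CompleteSpace W]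
    (E : EquivBimodule C D Y) (X : Submodule ℂ Y)
    (F : EquivBimodule C D W) (Z : Submodule ℂ W) : Prop :=
  ∃ Φ : E.Iso F, X.map Φ.toEquiv.toLinearMap = Z

def IsTrivialData {C : Type*}
    [NonUnitalCStarAlgebra C] [PartialOrder C] [StarOrderedRing C]
    (T : EquivBimodule C C C) : Prop :=
  T.lsmul = (fun c x => c * x) ∧ T.rsmul = (fun x c => x * c) ∧
    T.linn = (fun x y => x * star y) ∧ T.rinn = (fun x y => star x * y)

/-- The data of the equivalence bimodule `Y_σ` induced by an automorphism with
underlying map `σ` (with inverse `σinv`). -/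
def IsAlphaData {C : Type*}
    [NonUnitalCStarAlgebra C] [PartialOrder C] [StarOrderedRing C]
    (σ σinv : C → C) (T : EquivBimodule C C C) : Prop :=
  T.lsmul = (fun c x => c * x) ∧ T.rsmul = (fun x c => x * σ c) ∧
    T.linn = (fun x y => x * star y) ∧ T.rinn = (fun x y => σinv (star x * y))

/-- The submodule `{ι a | a : A}` of `C`, e.g. the subspace `X_α = A` of `Y_α = C`. -/
def rangeSub {A C : Type*} [NonUnitalCStarAlgebra C]
    (ι : A → C) : Submodule ℂ C :=
  Submodule.span ℂ (Set.range ι)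

/-- A realization of the interior tensor product `Y ⊗_D W` of equivalence bimodules. -/
structure IsTensorProd {C D L Y W V : Type*}
    [NonUnitalCStarAlgebra C] [PartialOrder C] [StarOrderedRing C]
    [NonUnitalCStarAlgebra D] [PartialOrder D] [StarOrderedRing D]
    [NonUnitalCStarAlgebra L] [PartialOrder L] [StarOrderedRing L]
    [NormedAddCommGroup Y] [NormedSpace ℂ Y] [CompleteSpace Y]
    [NormedAddCommGroup W] [NormedSpace ℂ W] [CompleteSpace W]
    [NormedAddCommGroup V] [NormedSpace ℂ V] [CompleteSpace V]
    (E : EquivBimodule C D Y) (G : EquivBimodule D L W)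
    (F : EquivBimodule C L V) (s : Y → W → V) : Prop where
  add_left : ∀ y y' w, s (y + y') w = s y w + s y' w
  smul_left : ∀ (z : ℂ) y w, s (z • y) w = z • s y w
  add_right : ∀ y w w', s y (w + w') = s y w + s y w'
  smul_right : ∀ (z : ℂ) y w, s y (z • w) = z • s y w
  balanced : ∀ y d w, s (E.rsmul y d) w = s y (G.lsmul d w)
  map_lsmul : ∀ c y w, F.lsmul c (s y w) = s (E.lsmul c y) w
  map_rsmul : ∀ y w l, F.rsmul (s y w) l = s y (G.rsmul w l)
  map_linn : ∀ y y' w w',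
    F.linn (s y w) (s y' w') = E.linn (E.rsmul y (G.linn w w')) y'
  map_rinn : ∀ y y' w w',
    F.rinn (s y w) (s y' w') = G.rinn w (G.lsmul (E.rinn y y') w')
  dense : Dense (Submodule.span ℂ {v : V | ∃ y w, v = s y w} : Set V)

/-- A realization of the product of two elements of `Equi(A, C)`:
the tensor product bimodule together with the distinguished subspace `X₁ ⊗ X₂`. -/
structure IsPairTensor {A C Y W V : Type*}
    [NonUnitalCStarAlgebra C] [PartialOrder C] [StarOrderedRing C]
    [NormedAddCommGroup Y] [NormedSpace ℂ Y] [CompleteSpace Y]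
    [NormedAddCommGroup W] [NormedSpace ℂ W] [CompleteSpace W]
    [NormedAddCommGroup V] [NormedSpace ℂ V] [CompleteSpace V]
    (ι : A → C)
    (E₁ : EquivBimodule C C Y) (X₁ : Submodule ℂ Y)
    (E₂ : EquivBimodule C C W) (X₂ : Submodule ℂ W)
    (G : EquivBimodule C C V) (XV : Submodule ℂ V) (s : Y → W → V) : Prop where
  tensor : IsTensorProd E₁ E₂ G s
  sub : (XV : Set V) =
    closure (Submodule.span ℂ {v : V | ∃ x ∈ X₁, ∃ z ∈ X₂, v = s x z} : Set V)

section Multiplier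

variable {C : Type*} [NonUnitalCStarAlgebra C]

/-- Conjugation `c ↦ u c u*` by a (unitary) multiplier `u ∈ M(C)`. -/
def mAd (u : 𝓜(ℂ, C)) (c : C) : C := u.fst ((star u).snd c)

/-- `m ∈ M(C)` is (the extension of) a multiplier of the subalgebra `A` (realized by
`ι : A → C`): it maps `A` into `A` on both sides.  When `AC` is dense in `C`, the
multiplier algebra `M(A)` is exactly the set of such multipliers. -/
def IsMultiplierOf {A : Type*} (ι : A → C) (m : 𝓜(ℂ, C)) : Prop :=
  (∀ a : A, m.fst (ι a) ∈ Set.range ι) ∧ (∀ a : A, m.snd (ι a) ∈ Set.range ι)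

/-- `u ∈ K(M(C))`: a unitary multiplier with `u a u*, u* a u ∈ A` for all `a ∈ A`. -/
def mem_KMC {A : Type*} (ι : A → C) (u : 𝓜(ℂ, C)) : Prop :=
  u ∈ unitary 𝓜(ℂ, C) ∧ (∀ a : A, mAd u (ι a) ∈ Set.range ι) ∧
    (∀ a : A, mAd (star u) (ι a) ∈ Set.range ι)

/-- The subspace `Au = {a u | a ∈ A}` of `C`, for a multiplier `u ∈ M(C)`. -/
def AuSub {A : Type*} (ι : A → C) (u : 𝓜(ℂ, C)) : Submodule ℂ C :=
  Submodule.span ℂ {x : C | ∃ a : A, x = u.snd (ι a)}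

end Multiplier

/-- A positive element `h` with `hA` dense in `A`; a C*-algebra is σ-unital iff it
possesses such a (strictly positive) element. -/
def SigmaUnital (A : Type*) [NonUnitalCStarAlgebra A] [PartialOrder A]
    [StarOrderedRing A] : Prop :=
  ∃ h : A, 0 ≤ h ∧ Dense (Set.range fun a : A => h * a)

/-- A system of matrix units over `C` realizing `Cs` as the stabilization `C ⊗ K`. -/
structure IsStabilization {C Cs : Type*} [NonUnitalCStarAlgebra C]
    [NonUnitalCStarAlgebra Cs] (e : ℕ → ℕ → C → Cs) : Prop where
  map_add : ∀ i j c c', e i j (c + c') = e i j c + e i j c'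
  map_smul : ∀ i j (z : ℂ) c, e i j (z • c) = z • e i j c
  map_mul : ∀ i j k l c d, e i j c * e k l d = if j = k then e i l (c * d) else 0
  map_star : ∀ i j c, star (e i j c) = e j i (star c)
  isometry : ∀ i j c, ‖e i j c‖ = ‖c‖
  dense : Dense (Submodule.span ℂ {x : Cs | ∃ i j c, x = e i j c} : Set Cs)

section Unital

variable {A B C D : Type*} [CStarAlgebra A] [CStarAlgebra B] [CStarAlgebra C] [CStarAlgebra D]
  [PartialOrder C] [StarOrderedRing C] [PartialOrder D] [StarOrderedRing D]

/-- A conditional expectation from `C` onto `A`, for a unital inclusion realized by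
`ι : A →⋆ₐ[ℂ] C`. -/
structure CondExpectation [PartialOrder A] [StarOrderedRing A] (ι : A →⋆ₐ[ℂ] C) where
  toFun : C → A
  map_add : ∀ x y, toFun (x + y) = toFun x + toFun y
  map_smul : ∀ (z : ℂ) x, toFun (z • x) = z • toFun x
  map_star : ∀ x, toFun (star x) = star (toFun x)
  retraction : ∀ a, toFun (ι a) = a
  left_mod : ∀ a c, toFun (ι a * c) = a * toFun c
  right_mod : ∀ c a, toFun (c * ι a) = toFun c * a
  pos : ∀ c, 0 ≤ toFun (star c * c)

/-- A quasi-basis for a conditional expectation, in the sense of Watatani. -/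
def IsQuasiBasis [PartialOrder A] [StarOrderedRing A] {ι : A →⋆ₐ[ℂ] C}
    (E : CondExpectation ι) {n : ℕ} (u : Fin n → C) : Prop :=
  ∀ c : C, (∑ i, u i * ι (E.toFun (star (u i) * c)) = c) ∧
    (∑ i, ι (E.toFun (c * u i)) * star (u i) = c)

/-- A conditional expectation is of Watatani index-finite type if it admits a
quasi-basis. -/
def FiniteIndex [PartialOrder A] [StarOrderedRing A] {ι : A →⋆ₐ[ℂ] C}
    (E : CondExpectation ι) : Prop :=
  ∃ (n : ℕ) (u : Fin n → C), IsQuasiBasis E u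

/-- `A' ∩ C = ℂ 1` for the inclusion realized by `ι`. -/
def IrreducibleIncl (ι : A →⋆ₐ[ℂ] C) : Prop :=
  ∀ c : C, (∀ a : A, ι a * c = c * ι a) → ∃ z : ℂ, c = z • (1 : C)

variable [PartialOrder A] [StarOrderedRing A] [PartialOrder B] [StarOrderedRing B]

/-- A conditional expectation `E^X : Y → X` with respect to `E^A` and `E^B`
(Definition 2.4 of [KT4]). -/
structure IsBimodCondExp {Y : Type*}
    [NormedAddCommGroup Y] [NormedSpace ℂ Y] [CompleteSpace Y]
    (ιA : A →⋆ₐ[ℂ] C) (ιB : B →⋆ₐ[ℂ] D)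
    (EA : CondExpectation ιA) (EB : CondExpectation ιB)
    (EY : EquivBimodule C D Y) (X : Submodule ℂ Y) (EX : Y → Y) : Prop where
  map_add : ∀ y y', EX (y + y') = EX y + EX y'
  map_smul : ∀ (z : ℂ) y, EX (z • y) = z • EX y
  mem : ∀ y, EX y ∈ X
  cond1 : ∀ (c : C), ∀ x ∈ X, EX (EY.lsmul c x) = EY.lsmul (ιA (EA.toFun c)) x
  cond2 : ∀ (a : A) (y : Y), EX (EY.lsmul (ιA a) y) = EY.lsmul (ιA a) (EX y)
  cond3 : ∀ (y : Y), ∀ x ∈ X, ιA (EA.toFun (EY.linn y x)) = EY.linn (EX y) x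
  cond4 : ∀ (d : D), ∀ x ∈ X, EX (EY.rsmul x d) = EY.rsmul x (ιB (EB.toFun d))
  cond5 : ∀ (b : B) (y : Y), EX (EY.rsmul y (ιB b)) = EY.rsmul (EX y) (ιB b)
  cond6 : ∀ (y : Y), ∀ x ∈ X, ιB (EB.toFun (EY.rinn y x)) = EY.rinn (EX y) x

/-- The C*-basic construction `C₁` for a conditional expectation `E : C → A`,
realized by a unital embedding `ιC : C →⋆ₐ[ℂ] C₁` and the Jones projection `e`. -/
structure IsBasicConstruction {A C C₁ : Type*} [CStarAlgebra A] [CStarAlgebra C]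
    [CStarAlgebra C₁] [PartialOrder A] [StarOrderedRing A]
    [PartialOrder C] [StarOrderedRing C]
    (ι : A →⋆ₐ[ℂ] C) (E : CondExpectation ι)
    (ιC : C →⋆ₐ[ℂ] C₁) (e : C₁) : Prop where
  inj : Function.Injective ιC
  idem : e * e = e
  selfadj : star e = e
  comm : ∀ a : A, ιC (ι a) * e = e * ιC (ι a)
  expect : ∀ c : C, e * ιC c * e = ιC (ι (E.toFun c)) * e
  faithful : ∀ c : C, ιC c * e = 0 → c = 0
  span : ∀ x : C₁, x ∈ Submodule.span ℂ {z : C₁ | ∃ c d : C, z = ιC c * e * ιC d}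

end Unital

/-- `M` is the `A–B`-equivalence bimodule obtained by restricting the operations of the
`C–D`-equivalence bimodule `EY` to the closed subspace `X` (whose inner products on `X`
take values in the subalgebras realized by `ιA`, `ιB`). -/
structure IsRestriction {A B C D Y : Type*}
    [NonUnitalCStarAlgebra A] [PartialOrder A] [StarOrderedRing A]
    [NonUnitalCStarAlgebra B] [PartialOrder B] [StarOrderedRing B]
    [NonUnitalCStarAlgebra C] [PartialOrder C] [StarOrderedRing C]
    [NonUnitalCStarAlgebra D] [PartialOrder D] [StarOrderedRing D]
    [NormedAddCommGroup Y] [NormedSpace ℂ Y] [CompleteSpace Y]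
    (ιA : A → C) (ιB : B → D)
    (EY : EquivBimodule C D Y) (X : Submodule ℂ Y) [CompleteSpace X]
    (M : EquivBimodule A B X) : Prop where
  lsmul_coe : ∀ (a : A) (x : X), (M.lsmul a x : Y) = EY.lsmul (ιA a) (x : Y)
  rsmul_coe : ∀ (x : X) (b : B), (M.rsmul x b : Y) = EY.rsmul (x : Y) (ιB b)
  linn_coe : ∀ x y : X, ιA (M.linn x y) = EY.linn (x : Y) (y : Y)
  rinn_coe : ∀ x y : X, ιB (M.rinn x y) = EY.rinn (x : Y) (y : Y)

section Upward

variable {A B C D C₁ D₁ : Type*} [CStarAlgebra A] [CStarAlgebra B] [CStarAlgebra C]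
  [CStarAlgebra D] [CStarAlgebra C₁] [CStarAlgebra D₁]
  [PartialOrder A] [StarOrderedRing A] [PartialOrder B] [StarOrderedRing B]
  [PartialOrder C] [StarOrderedRing C] [PartialOrder D] [StarOrderedRing D]
  [PartialOrder C₁] [StarOrderedRing C₁] [PartialOrder D₁] [StarOrderedRing D₁]

/-- A realization of the upward basic construction `C ⊗_A X ⊗_B D̃` as a
`C₁–D₁`-equivalence bimodule, where `M` is the middle `A–B`-equivalence bimodule
(`X` regarded as an `A–B`-bimodule), together with the canonical trilinear map `t`
(the map `(c, x, d) ↦ c ⊗ x ⊗ d̃`, conjugate-linear in the last variable). -/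
structure IsUpwardBasic {Xc T : Type*}
    [NormedAddCommGroup Xc] [NormedSpace ℂ Xc] [CompleteSpace Xc]
    [NormedAddCommGroup T] [NormedSpace ℂ T] [CompleteSpace T]
    (ιA : A →⋆ₐ[ℂ] C) (ιB : B →⋆ₐ[ℂ] D)
    (EA : CondExpectation ιA) (EB : CondExpectation ιB)
    (M : EquivBimodule A B Xc)
    (ιC : C →⋆ₐ[ℂ] C₁) (eA : C₁) (ιD : D →⋆ₐ[ℂ] D₁) (eB : D₁)
    (F : EquivBimodule C₁ D₁ T) (t : C → Xc → D → T) : Prop where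
  add₁ : ∀ c c' x d, t (c + c') x d = t c x d + t c' x d
  smul₁ : ∀ (z : ℂ) c x d, t (z • c) x d = z • t c x d
  add₂ : ∀ c x x' d, t c (x + x') d = t c x d + t c x' d
  smul₂ : ∀ (z : ℂ) c x d, t c (z • x) d = z • t c x d
  add₃ : ∀ c x d d', t c x (d + d') = t c x d + t c x d'
  smul₃ : ∀ (z : ℂ) c x d, t c x (z • d) = (starRingEnd ℂ z) • t c x d
  balanced₁ : ∀ (a : A) c x d, t (c * ιA a) x d = t c (M.lsmul a x) d
  balanced₂ : ∀ (b : B) c x d, t c (M.rsmul x b) d = t c x (d * ιB (star b))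
  map_lsmul : ∀ c' c x d, F.lsmul (ιC c') (t c x d) = t (c' * c) x d
  map_eA : ∀ c x d, F.lsmul eA (t c x d) = t (ιA (EA.toFun c)) x d
  map_rsmul : ∀ c x d d', F.rsmul (t c x d) (ιD d') = t c x (star d' * d)
  map_eB : ∀ c x d, F.rsmul (t c x d) eB = t c x (ιB (EB.toFun d))
  linn_eq : ∀ c c' x x' d d',
    F.linn (t c x d) (t c' x' d') =
      ιC (c * ιA (M.linn (M.rsmul x (EB.toFun (star d * d'))) x')) * eA * ιC (star c')
  rinn_eq : ∀ c c' x x' d d',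
    F.rinn (t c x d) (t c' x' d') =
      ιD d * eB * ιD (ιB (M.rinn x (M.lsmul (EA.toFun (star c * c')) x')) * star d')
  dense : Dense (Submodule.span ℂ {v : T | ∃ c x d, v = t c x d} : Set T)

end Upward



/-- The natural action of the second basic construction `C₂` on `C₁` (where `ιC1 x` acts
by left multiplication and the Jones projection `e_C` acts as `E^C`). -/
structure IsJonesAction {C C₁ C₂ : Type*}
    [CStarAlgebra C] [CStarAlgebra C₁] [CStarAlgebra C₂]
    [PartialOrder C] [StarOrderedRing C] [PartialOrder C₁] [StarOrderedRing C₁]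
    (ιC : C →⋆ₐ[ℂ] C₁) (EC : CondExpectation ιC)
    (ιC1 : C₁ →⋆ₐ[ℂ] C₂) (eC : C₂) (act : C₂ → C₁ → C₁) : Prop where
  add_left : ∀ z z' c, act (z + z') c = act z c + act z' c
  smul_left : ∀ (μ : ℂ) z c, act (μ • z) c = μ • act z c
  add_right : ∀ z c c', act z (c + c') = act z c + act z c'
  mul_act : ∀ z z' c, act (z * z') c = act z (act z' c)
  one_act : ∀ c, act 1 c = c
  embed_act : ∀ x c, act (ιC1 x) c = x * c
  jones_act : ∀ c, act eC c = ιC (EC.toFun c)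

/-- A realization of the `C–C`-equivalence bimodule
`C̃₁ ⊗_{C₂} Y₂ ⊗_{C₂} C₁`, where `C₁` is the `C₂–C`-equivalence bimodule given by the
basic constructions and `Y₂` is a `C₂–C₂`-equivalence bimodule; the map `u5` is
`(c₁, ξ, d₁) ↦ c̃₁ ⊗ ξ ⊗ d₁` (conjugate-linear in the first variable). -/
structure IsSandwich {C C₁ C₂ V₂ W5c : Type*}
    [CStarAlgebra C] [CStarAlgebra C₁] [CStarAlgebra C₂]
    [PartialOrder C] [StarOrderedRing C] [PartialOrder C₁] [StarOrderedRing C₁]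
    [PartialOrder C₂] [StarOrderedRing C₂]
    [NormedAddCommGroup V₂] [NormedSpace ℂ V₂] [CompleteSpace V₂]
    [NormedAddCommGroup W5c] [NormedSpace ℂ W5c] [CompleteSpace W5c]
    (ιC : C →⋆ₐ[ℂ] C₁) (EC : CondExpectation ιC)
    (ιC1 : C₁ →⋆ₐ[ℂ] C₂) (eC : C₂) (act : C₂ → C₁ → C₁)
    (G : EquivBimodule C₂ C₂ V₂)
    (W5 : EquivBimodule C C W5c) (u5 : C₁ → V₂ → C₁ → W5c) : Prop where
  add₁ : ∀ c₁ c₁' ξ d₁, u5 (c₁ + c₁') ξ d₁ = u5 c₁ ξ d₁ + u5 c₁' ξ d₁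
  smul₁ : ∀ (z : ℂ) c₁ ξ d₁, u5 (z • c₁) ξ d₁ = (starRingEnd ℂ z) • u5 c₁ ξ d₁
  add₂ : ∀ c₁ ξ ξ' d₁, u5 c₁ (ξ + ξ') d₁ = u5 c₁ ξ d₁ + u5 c₁ ξ' d₁
  smul₂ : ∀ (z : ℂ) c₁ ξ d₁, u5 c₁ (z • ξ) d₁ = z • u5 c₁ ξ d₁
  add₃ : ∀ c₁ ξ d₁ d₁', u5 c₁ ξ (d₁ + d₁') = u5 c₁ ξ d₁ + u5 c₁ ξ d₁'
  smul₃ : ∀ (z : ℂ) c₁ ξ d₁, u5 c₁ ξ (z • d₁) = z • u5 c₁ ξ d₁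
  bal₁a : ∀ (x : C₁) c₁ ξ d₁, u5 (star x * c₁) ξ d₁ = u5 c₁ (G.lsmul (ιC1 x) ξ) d₁
  bal₁b : ∀ c₁ ξ d₁, u5 (ιC (EC.toFun c₁)) ξ d₁ = u5 c₁ (G.lsmul eC ξ) d₁
  bal₂a : ∀ c₁ ξ (x : C₁) d₁, u5 c₁ (G.rsmul ξ (ιC1 x)) d₁ = u5 c₁ ξ (x * d₁)
  bal₂b : ∀ c₁ ξ d₁, u5 c₁ (G.rsmul ξ eC) d₁ = u5 c₁ ξ (ιC (EC.toFun d₁))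
  map_lsmul : ∀ (c : C) c₁ ξ d₁, W5.lsmul c (u5 c₁ ξ d₁) = u5 (c₁ * ιC (star c)) ξ d₁
  map_rsmul : ∀ c₁ ξ d₁ (c : C), W5.rsmul (u5 c₁ ξ d₁) c = u5 c₁ ξ (d₁ * ιC c)
  linn_eq : ∀ c₁ ξ d₁ c₁' ξ' d₁',
    W5.linn (u5 c₁ ξ d₁) (u5 c₁' ξ' d₁') =
      EC.toFun (star (act (star
        (G.linn (G.rsmul ξ (ιC1 d₁ * eC * ιC1 (star d₁'))) ξ')) c₁) * c₁')
  rinn_eq : ∀ c₁ ξ d₁ c₁' ξ' d₁',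
    W5.rinn (u5 c₁ ξ d₁) (u5 c₁' ξ' d₁') =
      EC.toFun (star d₁ *
        act (G.rinn ξ (G.lsmul (ιC1 c₁ * eC * ιC1 (star c₁')) ξ')) d₁')
  dense : Dense (Submodule.span ℂ {w : W5c | ∃ c₁ ξ d₁, w = u5 c₁ ξ d₁} : Set W5c)

/-- The unit of `C` acts as the identity on an equivalence bimodule. -/
theorem EquivBimodule.one_lsmul_aux {C D Y : Type*}
    [CStarAlgebra C] [PartialOrder C] [StarOrderedRing C]
    [NonUnitalCStarAlgebra D] [PartialOrder D] [StarOrderedRing D]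
    [NormedAddCommGroup Y] [NormedSpace ℂ Y] [CompleteSpace Y]
    (E : EquivBimodule C D Y) (y : Y) : E.lsmul 1 y = y := by
  have h : ∀ z, E.linn (y + (-1 : ℂ) • E.lsmul 1 y) z = 0 := by
    intro z
    rw [E.linn_add_left, E.linn_smul_left, E.linn_lsmul_left]
    simp
  have h2 := E.linn_definite _ (h _)
  rw [neg_one_smul, ← sub_eq_add_neg, sub_eq_zero] at h2
  exact h2.symm

/-- In the setting of a unital inclusion `A ⊆ C` with `A' ∩ C = ℂ1` and
`E^A` of index-finite type, with basic constructions `C₁`, `C₂`, an element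
`(X, Y) ∈ Equi(A, C)` with upward basic construction `Y₁ = C ⊗_A X ⊗_A C̃` and
`Y₂ = C₁ ⊗_C Y ⊗_C C̃₁`, the unique conditional expectation `E^{C̃⊗Y₁⊗C}` from
`C̃₁ ⊗_{C₂} C₁ ⊗_C Y ⊗_C C̃₁ ⊗_{C₂} C₁` onto `C̃ ⊗_{C₁} Y₁ ⊗_{C₁} C` satisfies
`E(c̃₁ ⊗ a₁ ⊗ y ⊗ b̃₁ ⊗ d₁) = (E^C(a₁* c₁))~ ⊗ y ⊗ E^C(b₁* d₁)`. -/
theorem sandwich_conditional_expectation_formula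
    {A C C₁ C₂ Yt T VG W5c : Type*}
    [CStarAlgebra A] [CStarAlgebra C] [CStarAlgebra C₁] [CStarAlgebra C₂]
    [PartialOrder A] [StarOrderedRing A] [PartialOrder C] [StarOrderedRing C]
    [PartialOrder C₁] [StarOrderedRing C₁] [PartialOrder C₂] [StarOrderedRing C₂]
    [NormedAddCommGroup Yt] [NormedSpace ℂ Yt] [CompleteSpace Yt]
    [NormedAddCommGroup T] [NormedSpace ℂ T] [CompleteSpace T]
    [NormedAddCommGroup VG] [NormedSpace ℂ VG] [CompleteSpace VG]
    [NormedAddCommGroup W5c] [NormedSpace ℂ W5c] [CompleteSpace W5c]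
    (ι : A →⋆ₐ[ℂ] C) (hι : Function.Injective ι)
    (EA : CondExpectation ι) {n : ℕ} (u : Fin n → C) (hu : IsQuasiBasis EA u)
    (hirr : IrreducibleIncl ι)
    (r : ℝ) (hr : 0 < r) (hInd : ∑ i, u i * star (u i) = (r : ℂ) • (1 : C))
    (ιC : C →⋆ₐ[ℂ] C₁) (eA : C₁) (hbc : IsBasicConstruction ι EA ιC eA)
    (EC : CondExpectation ιC)
    (hEC : ∀ c d : C, EC.toFun (ιC c * eA * ιC d) = (r⁻¹ : ℂ) • (c * d))
    (ιC1 : C₁ →⋆ₐ[ℂ] C₂) (eC : C₂) (hbc2 : IsBasicConstruction ιC EC ιC1 eC)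
    -- an element `(X, Y) ∈ Equi(A, C)`
    (EY : EquivBimodule C C Yt) (X : Submodule ℂ Yt) (hpair : IsEquiPair ⇑ι EY X)
    [CompleteSpace X] (MX : EquivBimodule A A X) (hMX : IsRestriction ⇑ι ⇑ι EY X MX)
    (EX : Yt → Yt) (hEX : IsBimodCondExp ι ι EA EA EY X EX)
    -- the upward basic construction `Y₁ = C ⊗_A X ⊗_A C̃`
    (F : EquivBimodule C₁ C₁ T) (t : C → X → C → T)
    (hup : IsUpwardBasic ι ι EA EA MX ιC eA ιC eA F t)
    -- the upward basic construction `Y₂ = C₁ ⊗_C Y ⊗_C C̃₁`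
    (G : EquivBimodule C₂ C₂ VG) (rg : C₁ → Yt → C₁ → VG)
    (hg : IsUpwardBasic ιC ιC EC EC EY ιC1 eC ιC1 eC G rg)
    -- the action of `C₂` on `C₁`
    (act : C₂ → C₁ → C₁) (hact : IsJonesAction ιC EC ιC1 eC act)
    -- the big module `C̃₁ ⊗_{C₂} Y₂ ⊗_{C₂} C₁`
    (W5 : EquivBimodule C C W5c) (u5 : C₁ → VG → C₁ → W5c)
    (h5 : IsSandwich ιC EC ιC1 eC act G W5 u5)
    -- the embedding `Y₁ ⊆ Y₂`, `c ⊗ x ⊗ d̃ ↦ Ind_W(E^A) · (c e_A) ⊗ x ⊗ (d e_A)~`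
    (ψ : T →ₗ[ℂ] VG)
    (hψ : ∀ (c : C) (x : X) (d : C),
      ψ (t c x d) = (r : ℂ) • rg (ιC c * eA) (x : Yt) (ιC d * eA))
    -- the closed subspace `C̃ ⊗_{C₁} Y₁ ⊗_{C₁} C` of the big module, `C` being embedded
    -- in `C₁` via `θ_C(c) = √r · c e_A`
    (Ssub : Submodule ℂ W5c)
    (hSsub : (Ssub : Set W5c) = closure (Submodule.span ℂ
      {v : W5c | ∃ (c d : C) (y₁ : T),
        v = u5 ((Real.sqrt r : ℂ) • (ιC c * eA)) (ψ y₁)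
          ((Real.sqrt r : ℂ) • (ιC d * eA))} : Set W5c))
    -- the (unique) conditional expectation onto it, with respect to `E^A` and `E^A`
    (Esub : W5c → W5c) (hEsub : IsBimodCondExp ι ι EA EA W5 Ssub Esub) :
    ∀ (a₁ b₁ c₁ d₁ : C₁) (y : Yt),
      Esub (u5 c₁ (rg a₁ y b₁) d₁) =
        u5 ((Real.sqrt r : ℂ) • (ιC (EC.toFun (star a₁ * c₁)) * eA))
          (ψ (∑ i, ∑ j, t (u i)
            ⟨EX (EY.lsmul (star (u i)) (EY.rsmul y (u j))), hEX.mem _⟩ (u j)))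
          ((Real.sqrt r : ℂ) • (ιC (EC.toFun (star b₁ * d₁)) * eA)) := by
  have EC1 : EC.toFun 1 = 1 := by
    have := EC.retraction 1
    rwa [map_one] at this
  -- the canonical copy of `Y` in the big module
  let J : Yt →ₗ[ℂ] W5c :=
    { toFun := fun y => u5 1 (rg 1 y 1) 1
      map_add' := fun y y' => by rw [hg.add₂, h5.add₂]
      map_smul' := fun z y => by rw [hg.smul₂, h5.smul₂]; rfl }
  have hJ : ∀ y, J y = u5 1 (rg 1 y 1) 1 := fun _ => rfl
  -- canonical form
  have left : ∀ (c₁ a₁ b₁ d₁ : C₁) (y : Yt), u5 c₁ (rg a₁ y b₁) d₁ =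
      u5 1 (rg 1 (EY.lsmul (star (EC.toFun (star a₁ * c₁))) y) b₁) d₁ := by
    intro c₁ a₁ b₁ d₁ y
    have e1 : rg a₁ y b₁ = G.lsmul (ιC1 a₁) (rg 1 y b₁) := by
      rw [hg.map_lsmul, mul_one]
    have e2 : rg 1 y b₁ = G.lsmul eC (rg 1 y b₁) := by
      rw [hg.map_eA, EC1, map_one]
    rw [e1, ← h5.bal₁a, e2, ← h5.bal₁b, ← hg.balanced₁, one_mul]
    generalize EC.toFun (star a₁ * c₁) = p
    have e3 : rg (ιC (star p)) y b₁ = G.lsmul (ιC1 (ιC (star p))) (rg 1 y b₁) := by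
      rw [hg.map_lsmul, mul_one]
    rw [e3, ← h5.bal₁a, map_star, star_star, mul_one]
  have right : ∀ (c₁ a₁ b₁ d₁ : C₁) (y : Yt), u5 c₁ (rg a₁ y b₁) d₁ =
      u5 c₁ (rg a₁ (EY.rsmul y (EC.toFun (star b₁ * d₁))) 1) 1 := by
    intro c₁ a₁ b₁ d₁ y
    have e1 : rg a₁ y b₁ = G.rsmul (rg a₁ y 1) (ιC1 (star b₁)) := by
      rw [hg.map_rsmul, mul_one, star_star]
    have e2 : rg a₁ y 1 = G.rsmul (rg a₁ y 1) eC := by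
      rw [hg.map_eB, EC1, map_one]
    rw [e1, h5.bal₂a, e2, h5.bal₂b, hg.balanced₂, one_mul]
    generalize EC.toFun (star b₁ * d₁) = p
    have e3 : rg a₁ y (ιC (star p)) = G.rsmul (rg a₁ y 1) (ιC1 (ιC p)) := by
      rw [hg.map_rsmul, mul_one, map_star]
    rw [e3, h5.bal₂a, mul_one]
  have canon : ∀ (c₁ a₁ b₁ d₁ : C₁) (y : Yt), u5 c₁ (rg a₁ y b₁) d₁ =
      J (EY.lsmul (star (EC.toFun (star a₁ * c₁)))
        (EY.rsmul y (EC.toFun (star b₁ * d₁)))) := by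
    intro c₁ a₁ b₁ d₁ y
    rw [right, left, hJ]
  have Jr : ∀ y d, W5.rsmul (J y) d = J (EY.rsmul y d) := by
    intro y d
    rw [hJ, h5.map_rsmul, right, star_one, one_mul, one_mul, EC.retraction, hJ]
  have hr0 : (r : ℂ) ≠ 0 := by exact_mod_cast hr.ne'
  have hs : (Real.sqrt r : ℂ) * (Real.sqrt r : ℂ) = r := by
    rw [← Complex.ofReal_mul, Real.mul_self_sqrt hr.le]
  have ECe : ∀ c d : C, EC.toFun (star (ιC c * eA) * (ιC d * eA)) =
      (r⁻¹ : ℂ) • ι (EA.toFun (star c * d)) := by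
    intro c d
    have : star (ιC c * eA) * (ιC d * eA) =
        ιC (ι (EA.toFun (star c * d))) * eA * ιC 1 := by
      rw [star_mul, hbc.selfadj, map_one, mul_one, ← hbc.expect, map_mul, map_star]
      simp only [mul_assoc]
    rw [this, hEC, mul_one]
  -- value of the generators of the subspace
  have gen : ∀ (c d c' d' : C) (x : X),
      u5 ((Real.sqrt r : ℂ) • (ιC c * eA)) (ψ (t c' x d'))
        ((Real.sqrt r : ℂ) • (ιC d * eA)) =
      J (EY.lsmul (ι (EA.toFun (star c * c')))
        (EY.rsmul (x : Yt) (ι (EA.toFun (star d' * d))))) := by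
    intro c d c' d' x
    rw [hψ, h5.smul₁, h5.smul₂, h5.smul₃, canon, ECe, ECe, star_smul, EY.smul_lsmul,
      EY.smul_rsmul, EY.lsmul_smul, map_smul, map_smul, Complex.conj_ofReal,
      ← map_star ι, ← EA.map_star, star_mul, star_star]
    simp only [smul_smul]
    have : (Real.sqrt r : ℂ) * (r * (Real.sqrt r * (star (r : ℂ)⁻¹ * (r : ℂ)⁻¹))) = 1 := by
      have e : star ((r : ℂ)⁻¹) = (r : ℂ)⁻¹ := by
        simp
      rw [e]
      calc _ = ((Real.sqrt r : ℂ) * (Real.sqrt r : ℂ)) * r * ((r : ℂ)⁻¹ * (r : ℂ)⁻¹) := by ring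
        _ = 1 := by rw [hs]; field_simp
    rw [← mul_assoc, ← mul_assoc, ← mul_assoc] at this
    simp only [← mul_assoc]
    rw [this, one_smul]
  have one_r : ∀ y, J (EY.rsmul y 1) = J y := by
    intro y
    rw [← Jr, hJ, h5.map_rsmul, map_one, mul_one]
  have EA1 : EA.toFun 1 = 1 := by
    have := EA.retraction 1
    rwa [map_one] at this
  have Jmem : ∀ x ∈ X, J x ∈ Ssub := by
    intro x hx
    have h := gen 1 1 1 1 ⟨x, hx⟩
    rw [star_one, mul_one, EA1, map_one ι, EY.one_lsmul_aux, one_r] at h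
    change J x ∈ (Ssub : Set W5c)
    rw [hSsub]
    exact subset_closure (Submodule.subset_span ⟨1, 1, _, h.symm⟩)
  let EXl : Yt →ₗ[ℂ] Yt :=
    { toFun := EX, map_add' := hEX.map_add, map_smul' := hEX.map_smul }
  let El : W5c →ₗ[ℂ] W5c :=
    { toFun := Esub, map_add' := hEsub.map_add, map_smul' := hEsub.map_smul }
  have key0 : ∀ s ∈ Submodule.span ℂ {c : C | ∃ (y : Yt), ∃ x ∈ X, c = EY.linn y x},
      ∀ y, El (J (EY.lsmul (star s) y)) = J (EXl (EY.lsmul (star s) y)) := by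
    intro s hs
    induction hs using Submodule.span_induction with
    | mem s h =>
      obtain ⟨y', x, hx, rfl⟩ := h
      intro y
      rw [EY.linn_star, EY.imprimitivity, ← Jr]
      change Esub _ = J (EX _)
      rw [hEsub.cond4 _ _ (Jmem x hx), hEX.cond4 _ _ hx, Jr]
    | zero =>
      intro y
      have : EY.lsmul (star 0) y = 0 := by
        have := EY.smul_lsmul 0 0 y
        rwa [zero_smul, zero_smul, ← star_zero] at this
      rw [this]; simp
    | add a b _ _ ha hb =>
      intro y
      rw [star_add, EY.add_lsmul]
      simp only [map_add, ha, hb]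
    | smul z a _ ha =>
      intro y
      rw [star_smul, EY.smul_lsmul]
      simp only [map_smul, ha]
  have key : ∀ y, Esub (J y) = J (EX y) := by
    intro y
    obtain ⟨s, hs1, hsS⟩ := hpair.span_YX_left.exists_mem_open Units.isOpen ⟨1, isUnit_one⟩
    obtain ⟨v, hv⟩ := (IsUnit.star (show IsUnit s from hsS))
    have h := key0 s hs1 (EY.lsmul (↑v⁻¹ : C) y)
    rw [← EY.mul_lsmul, ← hv, Units.mul_inv, EY.one_lsmul_aux] at h
    exact h
  intro a₁ b₁ c₁ d₁ y
  rw [canon, key]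
  generalize EC.toFun (star a₁ * c₁) = p
  generalize EC.toFun (star b₁ * d₁) = q
  let U : VG →ₗ[ℂ] W5c :=
    { toFun := fun ξ => u5 ((Real.sqrt r : ℂ) • (ιC p * eA)) ξ
        ((Real.sqrt r : ℂ) • (ιC q * eA))
      map_add' := fun _ _ => h5.add₂ _ _ _ _
      map_smul' := fun _ _ => h5.smul₂ _ _ _ _ }
  let Rl : Yt → C →ₗ[ℂ] Yt := fun y =>
    { toFun := fun d => EY.rsmul y d
      map_add' := fun _ _ => EY.rsmul_add _ _ _
      map_smul' := fun _ _ => EY.smul_rsmul _ _ _ }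
  let Ll : Yt → C →ₗ[ℂ] Yt := fun y =>
    { toFun := fun d => EY.lsmul d y
      map_add' := fun _ _ => EY.add_lsmul _ _ _
      map_smul' := fun _ _ => EY.smul_lsmul _ _ _ }
  let Lm : C → Yt →ₗ[ℂ] Yt := fun c =>
    { toFun := fun y => EY.lsmul c y
      map_add' := fun _ _ => EY.lsmul_add _ _ _
      map_smul' := fun _ _ => EY.lsmul_smul _ _ _ }
  have hterm : ∀ i j, U (ψ (t (u i)
      ⟨EX (EY.lsmul (star (u i)) (EY.rsmul y (u j))), hEX.mem _⟩ (u j))) =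
      J (EXl (Lm (ι (EA.toFun (star p * u i)) * star (u i))
        (Rl y (u j * ι (EA.toFun (star (u j) * q)))))) := by
    intro i j
    change u5 _ _ _ = J (EX (EY.lsmul _ (EY.rsmul _ _)))
    rw [gen, EY.mul_lsmul, hEX.cond2, EY.rsmul_mul, ← EY.lsmul_rsmul (star (u i)) (EY.rsmul y (u j)), hEX.cond5]
  change J (EXl _) = U _
  simp only [map_sum]
  simp only [hterm]
  simp only [← map_sum]
  congr 2
  have h1 : ∀ i, ∑ j, Lm (ι (EA.toFun (star p * u i)) * star (u i))
        (Rl y (u j * ι (EA.toFun (star (u j) * q)))) =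
      Ll (Rl y q) (ι (EA.toFun (star p * u i)) * star (u i)) := by
    intro i
    rw [← map_sum, ← map_sum, (hu q).1]
    rfl
  simp only [← map_sum, (hu q).1]
  change _ = ∑ i, Ll (Rl y q) (ι (EA.toFun (star p * u i)) * star (u i))
  rw [← map_sum, (hu (star p)).2]
  rfl

end
end

section
/- Let A ⊆ C be an inclusion of C*-algebras with AC dense in C, let f_C: Pic(A,C) → Pic(C) be the homomorphism [X,Y] ↦ [Y] into the ordinary Picard group of C, and let α ∈ Aut(A,C). Then [X_α, Y_α] ∈ Ker f_C if and only if there is a unitary u ∈ M(C) with uau*, u*au ∈ A for all a ∈ A such that [X_α, Y_α] = [Au, C] in Pic(A,C), where Au = {au : a ∈ A} is regarded as a closed subspace of the trivial C–C-equivalence bimodule C. -/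
open scoped MultiplierAlgebra

noncomputable section

/-- For `α ∈ Aut(A,C)`, the class `[X_α, Y_α]` lies in the kernel of
`f_C : Pic(A,C) → Pic(C)` (i.e. `Y_α ≅ C` as `C–C`-equivalence bimodules) if and only
if there is a unitary `u ∈ M(C)` with `u A u* ⊆ A` and `u* A u ⊆ A` such that
`[X_α, Y_α] = [Au, C]` in `Pic(A,C)`. -/
theorem kernel_fC_iff_Au
    {A C : Type*} [NonUnitalCStarAlgebra A]
    [NonUnitalCStarAlgebra C] [PartialOrder C] [StarOrderedRing C]
    (ι : A →⋆ₙₐ[ℂ] C) (hι : Function.Injective ι) (hd : DenseIncl ⇑ι)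
    (α : C ≃⋆ₐ[ℂ] C) (hα : ⇑α '' Set.range ⇑ι = Set.range ⇑ι)
    (Eα : EquivBimodule C C C) (hEα : IsAlphaData ⇑α ⇑α.symm Eα)
    (T : EquivBimodule C C C) (hT : IsTrivialData T) :
    Nonempty (Eα.Iso T) ↔
      ∃ u : 𝓜(ℂ, C), mem_KMC ⇑ι u ∧
        PairEquiv Eα (rangeSub ⇑ι) T (AuSub ⇑ι u) := by
  constructor
  swap
  · rintro ⟨u, _, Φ, _⟩
    exact ⟨Φ⟩
  rintro ⟨Φ⟩
  obtain ⟨hl, hr, hli, hri⟩ := hEα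
  obtain ⟨tl, tr, tli, tri⟩ := hT
  have h1 : ∀ c y, Φ.toEquiv (c * y) = c * Φ.toEquiv y := by
    intro c y; have h := Φ.map_lsmul c y; rw [hl, tl] at h; exact h
  have h2 : ∀ y d, Φ.toEquiv (y * α d) = Φ.toEquiv y * d := by
    intro y d; have h := Φ.map_rsmul y d; rw [hr, tr] at h; exact h
  have h3 : ∀ x y, Φ.toEquiv x * star (Φ.toEquiv y) = x * star y := by
    intro x y; have h := Φ.map_linn x y; rw [hli, tli] at h; exact h
  have h4 : ∀ x y, star (Φ.toEquiv x) * Φ.toEquiv y = α.symm (star x * y) := by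
    intro x y; have h := Φ.map_rinn x y; rw [hri, tri] at h; exact h
  have cancelR : ∀ x y : C, (∀ d, x * d = y * d) → x = y := by
    intro x y h
    have h0 : (x - y) * star (x - y) = 0 := by rw [sub_mul, h, sub_self]
    exact sub_eq_zero.mp (CStarRing.mul_star_self_eq_zero_iff _ |>.mp h0)
  have cancelL : ∀ x y : C, (∀ d, d * x = d * y) → x = y := by
    intro x y h
    have h0 : star (x - y) * (x - y) = 0 := by rw [mul_sub, h, sub_self]
    exact sub_eq_zero.mp (CStarRing.star_mul_self_eq_zero_iff _ |>.mp h0)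
  have P : ∀ c, Φ.toEquiv (star (Φ.toEquiv (α c))) = star c := by
    intro c
    apply cancelR
    intro d
    rw [← h2, h1, h4, map_mul, map_star, α.symm_apply_apply, α.symm_apply_apply]
  have M : ∀ c, Φ.toEquiv (α (star (Φ.toEquiv (star c)))) = c := by
    intro c
    apply cancelL
    intro x
    rw [← h1, h2, h3, star_star]
  have hnorm : ∀ x, ‖Φ.toEquiv x‖ = ‖x‖ := by
    intro x
    have h := congrArg norm (h3 x x)
    rw [CStarRing.norm_self_mul_star, CStarRing.norm_self_mul_star] at h
    exact (mul_self_inj (norm_nonneg _) (norm_nonneg _)).mp h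
  let S : C →L[ℂ] C := Φ.toEquiv.toLinearMap.mkContinuous 1 (fun x => by
    rw [one_mul]; exact (hnorm x).le)
  let F : C →L[ℂ] C :=
    LinearMap.mkContinuous
      { toFun := fun c => Φ.toEquiv (α c)
        map_add' := fun x y => by rw [map_add, map_add]
        map_smul' := fun z x => by rw [map_smul, map_smul]; rfl } 1 (fun x => by
      rw [one_mul]
      exact ((hnorm _).trans (NonUnitalStarAlgHom.norm_map α α.injective x)).le)
  let u : 𝓜(ℂ, C) := ⟨(F, S), fun x y => by
    change Φ.toEquiv x * y = x * Φ.toEquiv (α y)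
    rw [← h1, h2]⟩
  have uf : ∀ c, u.fst c = Φ.toEquiv (α c) := fun c => rfl
  have us : ∀ c, u.snd c = Φ.toEquiv c := fun c => rfl
  have suf : ∀ c, (star u).fst c = star (Φ.toEquiv (star c)) := fun c => rfl
  have sus : ∀ c, (star u).snd c = star (Φ.toEquiv (α (star c))) := fun c => rfl
  refine ⟨u, ⟨?_, ?_, ?_⟩, Φ, ?_⟩
  · rw [Unitary.mem_iff]
    constructor
    · apply DoubleCentralizer.ext
      apply Prod.ext
      · ext c
        change (star u).fst (u.fst c) = c
        rw [uf, suf, P, star_star]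
      · ext c
        change u.snd ((star u).snd c) = c
        rw [us, sus, P, star_star]
    · apply DoubleCentralizer.ext
      apply Prod.ext
      · ext c
        change u.fst ((star u).fst c) = c
        rw [uf, suf, M]
      · ext c
        change (star u).snd (u.snd c) = c
        rw [us, sus]
        have h := M (star c)
        rw [star_star] at h
        rw [h, star_star]
  · intro a
    have h : mAd u (ι a) = α (ι a) := by
      change u.fst ((star u).snd (ι a)) = _
      rw [uf, sus]
      apply cancelL
      intro x
      rw [← h1, h2, h3, map_star, star_star]
    rw [h, ← hα]
    exact ⟨_, ⟨a, rfl⟩, rfl⟩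
  · intro a
    have ha : ι a ∈ ⇑α '' Set.range ⇑ι := by rw [hα]; exact ⟨a, rfl⟩
    obtain ⟨_, ⟨b, rfl⟩, hb⟩ := ha
    refine ⟨b, ?_⟩
    change _ = (star u).fst ((star (star u)).snd (ι a))
    rw [star_star, us, suf, ← hb, P, star_star]
  · unfold rangeSub AuSub
    rw [Submodule.map_span]
    congr 1
    ext x
    constructor
    · rintro ⟨_, ⟨a, rfl⟩, rfl⟩
      exact ⟨a, rfl⟩
    · rintro ⟨a, rfl⟩
      exact ⟨_, ⟨a, rfl⟩, rfl⟩
end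
end

section
/- Let A ⊆ C be an inclusion of C*-algebras with AC dense in C and let u be a unitary in M(C) with uau*, u*au ∈ A for all a ∈ A (i.e. u ∈ K(M(C))). Then [Au, C] = [A, C] in Pic(A,C) if and only if there exists a unitary w ∈ M(A) such that w*u ∈ C' ∩ M(C). -/
open scoped MultiplierAlgebra

noncomputable section

section Helpers

variable {C : Type*} [NonUnitalCStarAlgebra C]

theorem aux_cancel_right {x y : C} (h : ∀ d, x * d = y * d) : x = y := by
  have := h (star (x - y))
  rw [← sub_eq_zero, ← sub_mul] at this
  exact sub_eq_zero.1 (CStarRing.mul_star_self_eq_zero_iff _ |>.1 this)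

theorem aux_cancel_left {x y : C} (h : ∀ d, d * x = d * y) : x = y := by
  have := h (star (x - y))
  rw [← sub_eq_zero, ← mul_sub] at this
  exact sub_eq_zero.1 (CStarRing.star_mul_self_eq_zero_iff _ |>.1 this)

theorem aux_snd_mul (v : 𝓜(ℂ, C)) (c d : C) : v.snd (c * d) = c * v.snd d :=
  aux_cancel_right fun e => by rw [v.central, mul_assoc, mul_assoc, v.central]

theorem aux_fst_mul (v : 𝓜(ℂ, C)) (c d : C) : v.fst (c * d) = v.fst c * d :=
  aux_cancel_left fun e => by rw [← v.central, ← mul_assoc, ← mul_assoc, v.central]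

theorem aux_snd_snd {v w : 𝓜(ℂ, C)} (h : v * w = 1) (c : C) : w.snd (v.snd c) = c := by
  have := congrArg (fun m : 𝓜(ℂ, C) => m.snd c) h
  exact this

theorem aux_fst_fst {v w : 𝓜(ℂ, C)} (h : v * w = 1) (c : C) : v.fst (w.fst c) = c := by
  have := congrArg (fun m : 𝓜(ℂ, C) => m.fst c) h
  exact this

theorem aux_central {v : 𝓜(ℂ, C)} (h : ∀ c : C, v * (c : 𝓜(ℂ, C)) = (c : 𝓜(ℂ, C)) * v) (c : C) :
    v.fst c = v.snd c := by
  refine aux_cancel_right fun d => ?_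
  have := congrArg (fun m : 𝓜(ℂ, C) => m.fst d) (h c)
  have h2 : v.fst (c * d) = c * v.fst d := this
  rw [← aux_fst_mul, h2, v.central]

theorem aux_central_of {v : 𝓜(ℂ, C)} (h : ∀ c : C, v.fst c = v.snd c) (c : C) :
    v * (c : 𝓜(ℂ, C)) = (c : 𝓜(ℂ, C)) * v := by
  apply DoubleCentralizer.ext
  refine Prod.ext ?_ ?_
  · refine ContinuousLinearMap.ext fun d => ?_
    change v.fst (c * d) = c * v.fst d
    rw [h, h, aux_snd_mul]
  · refine ContinuousLinearMap.ext fun d => ?_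
    change v.snd d * c = v.snd (d * c)
    rw [← h, ← h, aux_fst_mul]

theorem aux_rangeSub {A : Type*} [NonUnitalCStarAlgebra A] (ι : A →⋆ₙₐ[ℂ] C) (x : C) :
    x ∈ rangeSub ⇑ι ↔ x ∈ Set.range ι := by
  refine ⟨fun h => ?_, fun h => Submodule.subset_span h⟩
  induction h using Submodule.span_induction with
  | mem x h => exact h
  | zero => exact ⟨0, map_zero ι⟩
  | add x y _ _ hx hy =>
    obtain ⟨a, rfl⟩ := hx
    obtain ⟨b, rfl⟩ := hy
    exact ⟨a + b, map_add ι a b⟩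
  | smul z x _ hx =>
    obtain ⟨a, rfl⟩ := hx
    exact ⟨z • a, map_smul ι z a⟩

theorem aux_AuSub {A : Type*} [NonUnitalCStarAlgebra A] (ι : A →⋆ₙₐ[ℂ] C) (u : 𝓜(ℂ, C)) (x : C) :
    x ∈ AuSub ⇑ι u ↔ ∃ a, x = u.snd (ι a) := by
  refine ⟨fun h => ?_, fun h => Submodule.subset_span h⟩
  induction h using Submodule.span_induction with
  | mem x h => exact h
  | zero => exact ⟨0, by simp⟩
  | add x y _ _ hx hy =>
    obtain ⟨a, rfl⟩ := hx
    obtain ⟨b, rfl⟩ := hy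
    exact ⟨a + b, by simp⟩
  | smul z x _ hx =>
    obtain ⟨a, rfl⟩ := hx
    exact ⟨z • a, by simp⟩

end Helpers

/-- For a unitary `u ∈ K(M(C))` (i.e. `u A u*, u* A u ⊆ A`),
`[Au, C] = [A, C]` in `Pic(A,C)` if and only if there is a unitary `w ∈ M(A)` with
`w* u ∈ C' ∩ M(C)`. -/
theorem Au_eq_unit_iff
    {A C : Type*} [NonUnitalCStarAlgebra A]
    [NonUnitalCStarAlgebra C] [PartialOrder C] [StarOrderedRing C]
    (ι : A →⋆ₙₐ[ℂ] C) (hι : Function.Injective ι) (hd : DenseIncl ⇑ι)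
    (u : 𝓜(ℂ, C)) (hu : mem_KMC ⇑ι u)
    (T : EquivBimodule C C C) (hT : IsTrivialData T) :
    PairEquiv T (AuSub ⇑ι u) T (rangeSub ⇑ι) ↔
      ∃ w : 𝓜(ℂ, C), w ∈ unitary 𝓜(ℂ, C) ∧ IsMultiplierOf ⇑ι w ∧
        ∀ c : C, (star w * u) * (c : 𝓜(ℂ, C)) = (c : 𝓜(ℂ, C)) * (star w * u) := by
  obtain ⟨hl, hr, hli, hri⟩ := hT
  have hl' : ∀ c x, T.lsmul c x = c * x := fun c x => by rw [hl]
  have hr' : ∀ c x, T.rsmul c x = c * x := fun c x => by rw [hr]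
  have hli' : ∀ x y, T.linn x y = x * star y := fun c x => by rw [hli]
  have hri' : ∀ x y, T.rinn x y = star x * y := fun c x => by rw [hri]
  have hu1 := Unitary.star_mul_self_of_mem hu.1
  have hu2 := Unitary.mul_star_self_of_mem hu.1
  constructor
  · rintro ⟨Φ, hΦ⟩
    have m1 : ∀ c y, Φ.toEquiv (c * y) = c * Φ.toEquiv y := fun c y => by
      have := Φ.map_lsmul c y
      rwa [hl', hl'] at this
    have m2 : ∀ y d, Φ.toEquiv (y * d) = Φ.toEquiv y * d := fun y d => by
      have := Φ.map_rsmul y d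
      rwa [hr', hr'] at this
    have m4 : ∀ x y, star (Φ.toEquiv x) * Φ.toEquiv y = star x * y := fun x y => by
      have := Φ.map_rinn x y
      rwa [hri', hri'] at this
    have nrm : ∀ x, ‖Φ.toEquiv x‖ ≤ 1 * ‖x‖ := fun x => by
      have h1 := T.norm_rinn (Φ.toEquiv x)
      rw [Φ.map_rinn, T.norm_rinn] at h1
      rw [one_mul]
      exact (sq_le_sq₀ (norm_nonneg _) (norm_nonneg _)).1 h1.ge
    let L : C →L[ℂ] C := Φ.toEquiv.toLinearMap.mkContinuous 1 nrm
    have hL : ∀ x, L x = Φ.toEquiv x := fun x => rfl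
    let z : 𝓜(ℂ, C) := ⟨(L, L), fun x y => by
      change Φ.toEquiv x * y = x * Φ.toEquiv y
      rw [← m1, ← m2]⟩
    have key : ∀ x, Φ.toEquiv (star (Φ.toEquiv x)) = star x := fun x =>
      aux_cancel_right fun d => by rw [← m2, m1, m4]
    have key2 : ∀ x, star (Φ.toEquiv (star (Φ.toEquiv x))) = x := fun x => by
      rw [key, star_star]
    have key3 : ∀ x, Φ.toEquiv (star (Φ.toEquiv (star x))) = x := fun x => by
      rw [key, star_star]
    have z1 : star z * z = 1 := by
      apply DoubleCentralizer.ext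
      exact Prod.ext (ContinuousLinearMap.ext key2) (ContinuousLinearMap.ext key3)
    have z2 : z * star z = 1 := by
      apply DoubleCentralizer.ext
      exact Prod.ext (ContinuousLinearMap.ext key3) (ContinuousLinearMap.ext key2)
    have hw : u * z ∈ unitary 𝓜(ℂ, C) := mul_mem hu.1 (Unitary.mem_iff.2 ⟨z1, z2⟩)
    have hs : ∀ a, (u * z).snd (ι a) = Φ.toEquiv (u.snd (ι a)) := fun a => rfl
    refine ⟨u * z, hw, ⟨fun a => ?_, fun a => ?_⟩, ?_⟩
    · have h1 : ι (star a) ∈ rangeSub ⇑ι := (aux_rangeSub ι _).2 ⟨_, rfl⟩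
      rw [← hΦ] at h1
      obtain ⟨y, hy, hy2⟩ := h1
      obtain ⟨b, rfl⟩ := (aux_AuSub ι u y).1 hy
      have hy3 : (u * z).snd (ι b) = ι (star a) := hy2
      refine ⟨star b, ?_⟩
      have h2 := aux_snd_snd (Unitary.mul_star_self_of_mem hw) (ι b)
      rw [hy3, DoubleCentralizer.star_snd, map_star ι a, star_star] at h2
      rw [map_star, ← h2, star_star]
    · rw [hs, ← aux_rangeSub, ← hΦ]
      exact Submodule.mem_map_of_mem ((aux_AuSub ι u _).2 ⟨a, rfl⟩)
    · have e : star (u * z) * u = star z := by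
        rw [star_mul, mul_assoc, hu1, mul_one]
      rw [e]
      exact aux_central_of fun c => rfl
  · rintro ⟨w, hw, ⟨hwl, hwr⟩, hc⟩
    have hc' := aux_central hc
    have hz : star w * u ∈ unitary 𝓜(ℂ, C) := mul_mem (Unitary.star_mem hw) hu.1
    generalize hzz : star w * u = z at *
    have z1 := Unitary.star_mul_self_of_mem hz
    have z2 := Unitary.mul_star_self_of_mem hz
    have cs : ∀ c, (star z).fst c = (star z).snd c := fun c => by
      rw [DoubleCentralizer.star_fst, DoubleCentralizer.star_snd, hc']
    have uz : u * star z = w := by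
      rw [← hzz, star_mul, star_star, ← mul_assoc, hu2, one_mul]
    let e : C ≃ₗ[ℂ] C :=
      { toFun := fun x => (star z).snd x
        invFun := fun x => z.snd x
        map_add' := fun x y => map_add _ x y
        map_smul' := fun t x => map_smul _ t x
        left_inv := fun x => aux_snd_snd z1 x
        right_inv := fun x => aux_snd_snd z2 x }
    have he : ∀ x, e x = (star z).snd x := fun x => rfl
    refine ⟨⟨e, ?_, ?_, ?_, ?_⟩, ?_⟩
    · intro c y
      rw [hl', hl', he, he, aux_snd_mul]
    · intro y d
      rw [hr', hr', he, he, ← cs, ← cs, aux_fst_mul]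
    · intro x y
      have h1 : star ((star z).snd y) = z.fst (star y) := by
        rw [DoubleCentralizer.star_snd, star_star]
      rw [hli', hli', he, he, h1, (star z).central, aux_fst_fst z1]
    · intro x y
      have h1 : star ((star z).snd x) = z.snd (star x) := by
        rw [DoubleCentralizer.star_snd, star_star, hc']
      rw [hri', hri', he, he, h1, z.central, ← cs, aux_fst_fst z2]
    · ext x
      rw [aux_rangeSub]
      have hew : ∀ a, e (u.snd (ι a)) = w.snd (ι a) := fun a => by
        rw [← uz]
        rfl
      constructor
      · rintro ⟨y, hy, rfl⟩
        obtain ⟨a, rfl⟩ := (aux_AuSub ι u y).1 hy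
        change e (u.snd (ι a)) ∈ _
        rw [hew]
        exact hwr a
      · rintro ⟨a, rfl⟩
        obtain ⟨b, hb⟩ := hwl (star a)
        refine ⟨u.snd (ι (star b)), (aux_AuSub ι u _).2 ⟨_, rfl⟩, ?_⟩
        change e (u.snd (ι (star b))) = _
        rw [hew, map_star ι, hb, map_star ι, ← DoubleCentralizer.star_snd]
        exact aux_snd_snd (Unitary.star_mul_self_of_mem hw) _

end
end
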